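/- Let {A_i : E_i^1 ⊕ E_i^2 → E_{i+1}^1 ⊕ E_{i+1}^2}_{0 ≤ i < n} be a split sequence on ℝ^{2N}. If there are indices 0 ≤ i₀ < i₁ ≤ n such that the shorter split sequence {A_i : E_i^1 ⊕ E_i^2 → E_{i+1}^1 ⊕ E_{i+1}^2}_{i₀ ≤ i < i₁} is (ε,κ)-flexible, then the whole split sequence of length n is (ε,κ)-flexible. -/

import Mathlib

noncomputable section

open MeasureTheory

/-- The standard symplectic form `ω = Σᵢ dpᵢ ∧ dqᵢ` on `ℝ^{2N}`, where the
coordinates `p₁,…,p_N` occupy the first `N` indices and `q₁,…,q_N` the last `N`. -/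
def stdSymp (N : ℕ) (v w : EuclideanSpace ℝ (Fin (N + N))) : ℝ :=
  ∑ i : Fin N,
    (v (Fin.castAdd N i) * w (Fin.natAdd N i) - v (Fin.natAdd N i) * w (Fin.castAdd N i))

/-- `chain g n = g (n-1) ∘ ⋯ ∘ g 0` (the identity for `n = 0`). -/
def chain {α : Type*} (g : ℕ → α → α) : ℕ → α → α
  | 0 => id
  | n + 1 => g n ∘ chain g n

/-- A symplectomorphism of `ℝ^{2N}`: a `C¹` diffeomorphism whose derivative is
everywhere symplectic. -/
def IsSymplectomorph (N : ℕ) (g : EuclideanSpace ℝ (Fin (N + N)) → EuclideanSpace ℝ (Fin (N + N))) : Prop :=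
  Function.Bijective g ∧ ContDiff ℝ 1 g ∧ ContDiff ℝ 1 (Function.invFun g) ∧
    ∀ x v w, stdSymp N (fderiv ℝ g x v) (fderiv ℝ g x w) = stdSymp N v w

/-- A split sequence of length `n` on `ℝ^{2N}`: symplectic linear maps
`A 0, …, A (n-1)` together with invariant splittings `ℝ^{2N} = E1 i ⊕ E2 i`
(`0 ≤ i ≤ n`) into nonzero subspaces. -/
def IsSplitSeq (N n : ℕ)
    (A : ℕ → EuclideanSpace ℝ (Fin (N + N)) ≃ₗ[ℝ] EuclideanSpace ℝ (Fin (N + N)))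
    (E1 E2 : ℕ → Submodule ℝ (EuclideanSpace ℝ (Fin (N + N)))) : Prop :=
  (∀ i < n, ∀ v w, stdSymp N (A i v) (A i w) = stdSymp N v w) ∧
  (∀ i ≤ n, IsCompl (E1 i) (E2 i) ∧ E1 i ≠ ⊥ ∧ E2 i ≠ ⊥) ∧
  (∀ i < n, (E1 i).map (A i : EuclideanSpace ℝ (Fin (N + N)) →ₗ[ℝ] EuclideanSpace ℝ (Fin (N + N))) = E1 (i + 1) ∧
            (E2 i).map (A i : EuclideanSpace ℝ (Fin (N + N)) →ₗ[ℝ] EuclideanSpace ℝ (Fin (N + N))) = E2 (i + 1))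

/-- The angle `∠(E,F) ∈ [0,π/2]` between subspaces: the infimum of the angles
`∠(v,w)` over nonzero `v ∈ E`, `w ∈ F`.  (The set over which the infimum is taken
is augmented by `π/2`; since for nonzero subspaces the infimum of the angles is
always `≤ π/2`, this does not change its value, while it makes the angle equal to
the junk value `π/2` when one of the subspaces is trivial.) -/
def subAngle {V : Type*} [NormedAddCommGroup V] [InnerProductSpace ℝ V]
    (E F : Submodule ℝ V) : ℝ :=
  sInf ({Real.pi / 2} ∪
    {θ : ℝ | ∃ v ∈ E, v ≠ 0 ∧ ∃ w ∈ F, w ≠ 0 ∧ θ = InnerProductGeometry.angle v w})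

/-- The conditions (1)–(3) in the definition of `(ε,κ)`-flexibility, for a fixed
open set `U` and a fixed `γ > 0`: there are symplectomorphisms `g 0, …, g (n-1)`
of `ℝ^{2N}` such that (1) `g i` equals `A i` outside `A (i-1) ∘ ⋯ ∘ A 0 (U)`;
(2) `‖D((A i)⁻¹ ∘ g i)(x) − Id‖ < ε` everywhere; (3) there is a measurable
`G ⊆ U` with `μ(G) > (1−κ) μ(U)` on which
`∠(D(g (n-1) ∘ ⋯ ∘ g 0)(x)·E1 0, E2 n) < γ`. -/
def FlexWitness (N n : ℕ)
    (A : ℕ → EuclideanSpace ℝ (Fin (N + N)) ≃ₗ[ℝ] EuclideanSpace ℝ (Fin (N + N)))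
    (E1 E2 : ℕ → Submodule ℝ (EuclideanSpace ℝ (Fin (N + N))))
    (ε κ : ℝ) (U : Set (EuclideanSpace ℝ (Fin (N + N)))) (γ : ℝ) : Prop :=
  ∃ g : ℕ → EuclideanSpace ℝ (Fin (N + N)) → EuclideanSpace ℝ (Fin (N + N)),
    (∀ i < n, IsSymplectomorph N (g i)) ∧
    (∀ i < n, ∀ x ∉ chain (fun j => (A j : EuclideanSpace ℝ (Fin (N + N)) →
        EuclideanSpace ℝ (Fin (N + N)))) i '' U, g i x = A i x) ∧
    (∀ i < n, ∀ x, ‖fderiv ℝ (fun y => (A i).symm (g i y)) x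
        - ContinuousLinearMap.id ℝ (EuclideanSpace ℝ (Fin (N + N)))‖ < ε) ∧
    ∃ G : Set (EuclideanSpace ℝ (Fin (N + N))), G ⊆ U ∧ MeasurableSet G ∧
      ENNReal.ofReal (1 - κ) * volume U < volume G ∧
      ∀ x ∈ G, subAngle ((E1 0).map (fderiv ℝ (chain g n) x :
        EuclideanSpace ℝ (Fin (N + N)) →ₗ[ℝ] EuclideanSpace ℝ (Fin (N + N)))) (E2 n) < γ

/-- `(ε,κ)`-flexibility of a split sequence: for every `γ > 0` there is a bounded
open neighborhood `U` of `0` for which the conditions (1)–(3) hold. -/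
def IsFlexible (N n : ℕ)
    (A : ℕ → EuclideanSpace ℝ (Fin (N + N)) ≃ₗ[ℝ] EuclideanSpace ℝ (Fin (N + N)))
    (E1 E2 : ℕ → Submodule ℝ (EuclideanSpace ℝ (Fin (N + N))))
    (ε κ : ℝ) : Prop :=
  ∀ γ > (0:ℝ), ∃ U : Set (EuclideanSpace ℝ (Fin (N + N))),
    IsOpen U ∧ Bornology.IsBounded U ∧ (0 : EuclideanSpace ℝ (Fin (N + N))) ∈ U ∧
    FlexWitness N n A E1 E2 ε κ U γ

theorem chain_add {α : Type*} (g : ℕ → α → α) (a b : ℕ) :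
    chain g (a + b) = chain (fun j => g (a + j)) b ∘ chain g a := by
  induction b with
  | zero => rfl
  | succ b ih =>
    change g (a + b) ∘ chain g (a + b) = _
    rw [ih]
    rfl

theorem chain_congr {α : Type*} {g h : ℕ → α → α} {m : ℕ} (H : ∀ i < m, g i = h i) :
    chain g m = chain h m := by
  induction m with
  | zero => rfl
  | succ m ih =>
    change g m ∘ chain g m = h m ∘ chain h m
    rw [ih fun i hi => H i (by omega), H m (by omega)]

/-- A chain of linear automorphisms is a continuous linear automorphism, and it transports
any family of subspaces that is invariant along the chain. -/
theorem exists_continuousLinearEquiv_chain {V : Type*} [NormedAddCommGroup V] [NormedSpace ℝ V]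
    [FiniteDimensional ℝ V] (A : ℕ → V ≃ₗ[ℝ] V) (m : ℕ) :
    ∃ L : V ≃L[ℝ] V, chain (fun j => (A j : V → V)) m = L ∧
      ∀ E : ℕ → Submodule ℝ V, (∀ j < m, (E j).map (A j : V →ₗ[ℝ] V) = E (j + 1)) →
        (E 0).map ((L : V →L[ℝ] V) : V →ₗ[ℝ] V) = E m := by
  induction m with
  | zero => exact ⟨.refl ℝ V, rfl, fun E _ => by ext; simp⟩
  | succ m ih =>
    obtain ⟨L, hL, hE⟩ := ih
    refine ⟨L.trans (A m).toContinuousLinearEquiv, ?_, fun E h => ?_⟩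
    · change _ ∘ chain _ m = _
      rw [hL]
      rfl
    · rw [← h m (by omega), ← hE E fun j hj => h j (by omega), ← Submodule.map_comp]
      rfl

/-- A linear automorphism of a finite-dimensional space sends vectors forming a small angle to
vectors forming a small angle, uniformly. -/
theorem exists_angle_map_lt {V : Type*} [NormedAddCommGroup V] [InnerProductSpace ℝ V]
    [FiniteDimensional ℝ V] (L : V ≃L[ℝ] V) {γ : ℝ} (hγ : 0 < γ) :
    ∃ δ > 0, ∀ v w : V, v ≠ 0 → w ≠ 0 → InnerProductGeometry.angle v w < δ →
      InnerProductGeometry.angle (L v) (L w) < γ := by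
  set S : Set (V × V) := Metric.sphere 0 1 ×ˢ Metric.sphere 0 1
  have hS : IsCompact S := (isCompact_sphere _ _).prod (isCompact_sphere _ _)
  have hne : ∀ p ∈ S, p.1 ≠ 0 ∧ p.2 ≠ 0 := fun p hp =>
    ⟨ne_zero_of_mem_unit_sphere ⟨p.1, hp.1⟩, ne_zero_of_mem_unit_sphere ⟨p.2, hp.2⟩⟩
  have hc : ContinuousOn (fun p : V × V => InnerProductGeometry.angle p.1 p.2) S := fun p hp =>
    (InnerProductGeometry.continuousAt_angle (hne p hp).1 (hne p hp).2).continuousWithinAt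
  have hcL : ContinuousOn (fun p : V × V => InnerProductGeometry.angle (L p.1) (L p.2)) S := by
    intro p hp
    have h := InnerProductGeometry.continuousAt_angle (x := (L p.1, L p.2))
      (by simpa using (hne p hp).1) (by simpa using (hne p hp).2)
    exact (ContinuousAt.comp (f := fun p : V × V => (L p.1, L p.2)) h
      (by fun_prop)).continuousWithinAt
  set K : Set (V × V) := S ∩ (fun p => InnerProductGeometry.angle (L p.1) (L p.2)) ⁻¹' Set.Ici γ
  have hK : IsCompact K :=
    hS.of_isClosed_subset (hcL.preimage_isClosed_of_isClosed hS.isClosed isClosed_Ici)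
      Set.inter_subset_left
  obtain ⟨δ, hδ, hmin⟩ : ∃ δ > 0, ∀ p ∈ K, δ ≤ InnerProductGeometry.angle p.1 p.2 := by
    rcases K.eq_empty_or_nonempty with he | hn
    · exact ⟨1, one_pos, by simp [he]⟩
    · obtain ⟨p, hp, hpm⟩ := hK.exists_isMinOn hn (hc.mono Set.inter_subset_left)
      refine ⟨_, (InnerProductGeometry.angle_nonneg p.1 p.2).lt_of_ne fun h => ?_,
        fun q hq => hpm hq⟩
      obtain ⟨h1, r, hr, h2⟩ := InnerProductGeometry.angle_eq_zero_iff.1 h.symm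
      have h3 : InnerProductGeometry.angle (L p.1) (L p.2) = 0 :=
        InnerProductGeometry.angle_eq_zero_iff.2 ⟨by simpa using h1, r, hr, by rw [h2, map_smul]⟩
      have h4 : γ ≤ InnerProductGeometry.angle (L p.1) (L p.2) := hp.2
      linarith
  refine ⟨δ, hδ, fun v w hv hw h => ?_⟩
  by_contra! hcon
  have hv' : 0 < ‖v‖⁻¹ := by positivity
  have hw' : 0 < ‖w‖⁻¹ := by positivity
  refine absurd (hmin (‖v‖⁻¹ • v, ‖w‖⁻¹ • w) ⟨⟨?_, ?_⟩, ?_⟩) (not_le.2 ?_)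
  · simp [norm_smul, hv]
  · simp [norm_smul, hw]
  · change γ ≤ InnerProductGeometry.angle (L (‖v‖⁻¹ • v)) (L (‖w‖⁻¹ • w))
    rwa [map_smul, map_smul, InnerProductGeometry.angle_smul_left_of_pos _ _ hv',
      InnerProductGeometry.angle_smul_right_of_pos _ _ hw']
  · rwa [InnerProductGeometry.angle_smul_left_of_pos _ _ hv',
      InnerProductGeometry.angle_smul_right_of_pos _ _ hw']

theorem exists_subAngle_map_lt {V : Type*} [NormedAddCommGroup V] [InnerProductSpace ℝ V]
    [FiniteDimensional ℝ V] (L : V ≃L[ℝ] V) {γ : ℝ} (hγ : 0 < γ) :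
    ∃ δ > 0, ∀ E F : Submodule ℝ V, subAngle E F < δ →
      subAngle (E.map ((L : V →L[ℝ] V) : V →ₗ[ℝ] V))
        (F.map ((L : V →L[ℝ] V) : V →ₗ[ℝ] V)) < γ := by
  obtain ⟨δ, hδ, h⟩ := exists_angle_map_lt L hγ
  refine ⟨min δ (Real.pi / 2), lt_min hδ (by positivity), fun E F hEF => ?_⟩
  obtain ⟨θ, hθ | ⟨v, hv, hv0, w, hw, hw0, rfl⟩, hlt⟩ :=
    exists_lt_of_csInf_lt ⟨_, Set.mem_union_left _ (Set.mem_singleton _)⟩ hEF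
  · rw [Set.mem_singleton_iff] at hθ
    exact absurd (hθ ▸ hlt) (not_lt.2 (min_le_right _ _))
  · refine lt_of_le_of_lt (csInf_le ⟨0, ?_⟩ (Set.mem_union_right _
      ⟨L v, Submodule.mem_map_of_mem hv, by simpa using hv0,
        L w, Submodule.mem_map_of_mem hw, by simpa using hw0, rfl⟩))
      (h v w hv0 hw0 (hlt.trans_le (min_le_left _ _)))
    rintro θ (hθ | ⟨_, _, _, _, _, _, rfl⟩)
    · rw [Set.mem_singleton_iff.1 hθ]
      positivity
    · exact InnerProductGeometry.angle_nonneg _ _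

theorem isSymplectomorph_linearEquiv {N : ℕ}
    (A : EuclideanSpace ℝ (Fin (N + N)) ≃ₗ[ℝ] EuclideanSpace ℝ (Fin (N + N)))
    (hA : ∀ v w, stdSymp N (A v) (A w) = stdSymp N v w) : IsSymplectomorph N A := by
  have hinv : Function.invFun A = A.symm :=
    funext fun x => A.injective <| by
      rw [Function.invFun_eq (A.surjective x), A.apply_symm_apply]
  refine ⟨A.bijective, A.toContinuousLinearEquiv.contDiff, ?_, fun x v w => ?_⟩
  · rw [hinv]
    exact A.symm.toContinuousLinearEquiv.contDiff
  · have : fderiv ℝ A x = A.toContinuousLinearEquiv := A.toContinuousLinearEquiv.fderiv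
    rw [this]
    exact hA v w

/-- If for some `0 ≤ i₀ < i₁ ≤ n` the shorter split sequence
`{A i, E1 i, E2 i}` for `i₀ ≤ i < i₁` (reindexed as `j ↦ i₀ + j`) is
`(ε,κ)`-flexible, then so is the whole split sequence of length `n`. -/
theorem stmt_14 (N n : ℕ) (hN : 0 < N)
    (A : ℕ → EuclideanSpace ℝ (Fin (N + N)) ≃ₗ[ℝ] EuclideanSpace ℝ (Fin (N + N)))
    (E1 E2 : ℕ → Submodule ℝ (EuclideanSpace ℝ (Fin (N + N))))
    (hsplit : IsSplitSeq N n A E1 E2)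
    (ε κ : ℝ) (hε : 0 < ε) (hκ : 0 < κ)
    (i₀ i₁ : ℕ) (h01 : i₀ < i₁) (h1n : i₁ ≤ n)
    (hshort : IsFlexible N (i₁ - i₀) (fun j => A (i₀ + j))
      (fun j => E1 (i₀ + j)) (fun j => E2 (i₀ + j)) ε κ) :
    IsFlexible N n A E1 E2 ε κ := by
  obtain ⟨hsymp, -, hmap⟩ := hsplit
  obtain ⟨a, rfl⟩ : ∃ a, i₁ = i₀ + a := ⟨i₁ - i₀, by omega⟩
  obtain ⟨b, rfl⟩ : ∃ b, n = i₀ + a + b := ⟨n - (i₀ + a), by omega⟩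
  rw [Nat.add_sub_cancel_left] at hshort
  obtain ⟨B, hB, hBE⟩ := exists_continuousLinearEquiv_chain A i₀
  obtain ⟨C, hC, hCE⟩ := exists_continuousLinearEquiv_chain (fun j => A (i₀ + a + j)) b
  have hBE1 := hBE E1 fun j hj => (hmap j (by omega)).1
  have hCE2 := hCE (fun j => E2 (i₀ + a + j)) fun j hj => (hmap (i₀ + a + j) (by omega)).2
  intro γ hγ
  obtain ⟨δ, hδ, hangle⟩ := exists_subAngle_map_lt C hγ
  obtain ⟨U, hUo, hUb, hU0, g, hg, hgA, hgε, G, hGU, hGm, hGμ, hGδ⟩ := hshort δ hδ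
  set f : ℕ → EuclideanSpace ℝ (Fin (N + N)) → EuclideanSpace ℝ (Fin (N + N)) :=
    fun i => if i₀ ≤ i ∧ i < i₀ + a then g (i - i₀) else A i with hf
  have hfg : ∀ j < a, f (i₀ + j) = g j := fun j hj => by simp [hf, hj]
  have hfA : ∀ i, ¬(i₀ ≤ i ∧ i < i₀ + a) → f i = A i := fun i hi => if_neg hi
  have hcases : ∀ i, (∃ j < a, i = i₀ + j) ∨ ¬(i₀ ≤ i ∧ i < i₀ + a) := fun i => by
    by_cases h : i₀ ≤ i ∧ i < i₀ + a
    · exact .inl ⟨i - i₀, by omega, by omega⟩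
    · exact .inr h
  have hchain : chain f (i₀ + a + b) = C ∘ (chain g a ∘ B) := by
    rw [chain_add, chain_add, ← hB, ← hC,
      chain_congr (g := f) fun i (hi : i < i₀) => hfA i (by omega),
      chain_congr (g := fun j => f (i₀ + j)) hfg,
      chain_congr (g := fun j => f (i₀ + a + j)) fun i (hi : i < b) => hfA _ (by omega)]
  refine ⟨B ⁻¹' U, hUo.preimage B.continuous, ?_, by simpa using hU0, f, fun i hi => ?_,
    fun i hi x hx => ?_, fun i hi x => ?_, B ⁻¹' G, Set.preimage_mono hGU,
    B.continuous.measurable hGm, ?_, fun x hx => ?_⟩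
  · exact B.antilipschitz.isBounded_preimage hUb
  · obtain ⟨j, hj, rfl⟩ | h := hcases i
    · exact hfg j hj ▸ hg j hj
    · exact hfA i h ▸ isSymplectomorph_linearEquiv (A i) (hsymp i hi)
  · obtain ⟨j, hj, rfl⟩ | h := hcases i
    · rw [hfg j hj]
      refine hgA j hj x ?_
      rwa [chain_add, hB, Set.image_comp, Set.image_preimage_eq _ B.surjective] at hx
    · rw [hfA i h]
  · obtain ⟨j, hj, rfl⟩ | h := hcases i
    · rw [hfg j hj]
      exact hgε j hj x
    · rw [hfA i h]
      simpa using hε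
  · have hdet : LinearMap.det (B.toLinearEquiv : EuclideanSpace ℝ (Fin (N + N)) →ₗ[ℝ]
        EuclideanSpace ℝ (Fin (N + N))) ≠ 0 :=
      B.toLinearEquiv.isUnit_det'.ne_zero
    have hvol := Measure.addHaar_preimage_linearMap
      (volume : Measure (EuclideanSpace ℝ (Fin (N + N)))) hdet
    have hU : volume (B ⁻¹' U) = _ := hvol U
    have hG : volume (B ⁻¹' G) = _ := hvol G
    rw [hU, hG, mul_left_comm]
    exact ENNReal.mul_right_strictMono (by simpa using hdet) ENNReal.ofReal_ne_top hGμ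
  · have hderiv : fderiv ℝ (chain f (i₀ + a + b)) x =
        (C : EuclideanSpace ℝ (Fin (N + N)) →L[ℝ] _) ∘L (fderiv ℝ (chain g a) (B x) ∘L
          (B : EuclideanSpace ℝ (Fin (N + N)) →L[ℝ] _)) := by
      rw [hchain, C.comp_fderiv, B.comp_right_fderiv]
    have hlt := hangle _ _ (hGδ (B x) hx)
    rw [hderiv, ContinuousLinearMap.toLinearMap_comp, ContinuousLinearMap.toLinearMap_comp,
      Submodule.map_comp, Submodule.map_comp, hBE1, ← hCE2]
    exact hlt
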